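/- Let F = {f_1, …, f_k} (k ≥ 1) be a system of tropical polynomials in n variables over ℝ, let d_j = deg f_j, and set N = (n+2)(d_1 + ⋯ + d_k). Then F has no root in ℝ^n if and only if there exists a nonsingular tropical algebraic combination of F of degree at most N. -/

import Mathlib

open scoped Classical

/-- Exponent vectors in `n` variables. -/
abbrev Exp (n : ℕ) : Type := Fin n → ℕ

/-- The total degree `|I|` of an exponent vector. -/
def expDeg {n : ℕ} (I : Exp n) : ℕ := ∑ j, I j

/-- A tropical polynomial: a finite nonempty support of exponent vectors
together with real coefficients. -/
structure TropPoly (n : ℕ) where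
  supp : Finset (Exp n)
  supp_nonempty : supp.Nonempty
  coeff : Exp n → ℝ

/-- The degree of a tropical polynomial. -/
def TropPoly.deg {n : ℕ} (f : TropPoly n) : ℕ := f.supp.sup expDeg

/-- Value of the monomial of `f` with exponent `I` at a point of `ℝ^n`. -/
def TropPoly.mono {n : ℕ} (f : TropPoly n) (I : Exp n) (a : Fin n → ℝ) : ℝ :=
  f.coeff I + ∑ j, (I j : ℝ) * a j

/-- Value of a tropical polynomial at a point of `ℝ^n`. -/
def TropPoly.eval {n : ℕ} (f : TropPoly n) (a : Fin n → ℝ) : ℝ :=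
  f.supp.inf' f.supp_nonempty (fun I => f.mono I a)

/-- A point of `ℝ^n` is a root if the minimum is attained at two distinct monomials. -/
def TropPoly.IsRoot {n : ℕ} (f : TropPoly n) (a : Fin n → ℝ) : Prop :=
  ∃ I ∈ f.supp, ∃ J ∈ f.supp, I ≠ J ∧
    f.mono I a = f.eval a ∧ f.mono J a = f.eval a

/-- Value of the monomial of `f` with exponent `I` at a point of `ℝ∞^n`
(with the convention `0 • ⊤ = 0`). -/
noncomputable def TropPoly.monoT {n : ℕ} (f : TropPoly n) (I : Exp n)
    (a : Fin n → WithTop ℝ) : WithTop ℝ :=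
  (f.coeff I : WithTop ℝ) + ∑ j, (I j) • a j

/-- Value of a tropical polynomial at a point of `ℝ∞^n`. -/
noncomputable def TropPoly.evalT {n : ℕ} (f : TropPoly n) (a : Fin n → WithTop ℝ) : WithTop ℝ :=
  f.supp.inf (fun I => f.monoT I a)

/-- A point of `ℝ∞^n` is a root if the minimum is `+∞` or is attained at two
distinct monomials. -/
noncomputable def TropPoly.IsRootT {n : ℕ} (f : TropPoly n) (a : Fin n → WithTop ℝ) : Prop :=
  f.evalT a = ⊤ ∨ ∃ I ∈ f.supp, ∃ J ∈ f.supp, I ≠ J ∧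
    f.monoT I a = f.evalT a ∧ f.monoT J a = f.evalT a

/-- The coefficient of the monomial `x^I` in `x^J ⊙ f`, which is `+∞`
unless `I - J` belongs to the support of `f`. -/
noncomputable def shiftCoeff {n : ℕ} (f : TropPoly n) (J I : Exp n) : WithTop ℝ :=
  if J ≤ I ∧ I - J ∈ f.supp then (f.coeff (I - J) : WithTop ℝ) else ⊤

/-- The entry `c_{f}(I-J) + y_I` of the Macaulay system. -/
noncomputable def macVal {n : ℕ} (f : TropPoly n) (J : Exp n)
    (y : Exp n → WithTop ℝ) (I : Exp n) : WithTop ℝ :=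
  shiftCoeff f J I + y I

/-- The data of a tropical algebraic combination of a system of `k` tropical polynomials
in `n` variables: a finite nonempty list of triples `(c_l, J_l, i_l)`. -/
structure TropComb (n k : ℕ) where
  K : ℕ
  K_pos : 0 < K
  c : Fin K → ℝ
  J : Fin K → Exp n
  idx : Fin K → Fin k

/-- The value `c_l + c_{f_{i_l}}(I - J_l)` contributed by the `l`-th summand at the
exponent vector `I`. -/
noncomputable def TropComb.term {n k : ℕ} (comb : TropComb n k) (F : Fin k → TropPoly n)
    (l : Fin comb.K) (I : Exp n) : WithTop ℝ :=
  (comb.c l : WithTop ℝ) + shiftCoeff (F (comb.idx l)) (comb.J l) I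

/-- The coefficient `g_I = min_l (c_l + c_{f_{i_l}}(I - J_l))` of the combination. -/
noncomputable def TropComb.gCoeff {n k : ℕ} (comb : TropComb n k) (F : Fin k → TropPoly n)
    (I : Exp n) : WithTop ℝ :=
  Finset.univ.inf (fun l : Fin comb.K => comb.term F l I)

/-- The combination has degree at most `N`. -/
def TropComb.DegLE {n k : ℕ} (comb : TropComb n k) (F : Fin k → TropPoly n)
    (N : ℕ) : Prop :=
  ∀ l : Fin comb.K, expDeg (comb.J l) + (F (comb.idx l)).deg ≤ N

/-- The combination is nonsingular: for every exponent vector `I` with finite coefficient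
there is a (necessarily unique) index `l(I)` whose contribution is strictly smaller than
that of every other index, and `l(I) ≠ l(I')` for distinct `I ≠ I'` with finite
coefficients. -/
noncomputable def TropComb.Nonsingular {n k : ℕ} (comb : TropComb n k)
    (F : Fin k → TropPoly n) : Prop :=
  ∃ sel : Exp n → Fin comb.K,
    (∀ I : Exp n, comb.gCoeff F I ≠ ⊤ →
      ∀ l : Fin comb.K, l ≠ sel I → comb.term F (sel I) I < comb.term F l I) ∧
    (∀ I I' : Exp n, comb.gCoeff F I ≠ ⊤ → comb.gCoeff F I' ≠ ⊤ → I ≠ I' →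
      sel I ≠ sel I')


theorem aux_between {ι : Type} [Fintype ι] (P Q : ι → Prop) (u v : ι → ℝ)
    (h : ∀ p q, P p → Q q → v q ≤ u p) :
    ∃ x : ℝ, (∀ p, P p → x ≤ u p) ∧ (∀ q, Q q → v q ≤ x) := by
  by_cases hQ : ∃ q, Q q
  · obtain ⟨q0, hq0⟩ := hQ
    obtain ⟨q, hq, hmax⟩ := Finset.exists_max_image (Finset.univ.filter Q) v ⟨q0, by simp [hq0]⟩
    refine ⟨v q, fun p hp => h p q hp (by simpa using hq), fun q' hq' => hmax q' (by simp [hq'])⟩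
  · by_cases hP : ∃ p, P p
    · obtain ⟨q0, hq0⟩ := hP
      obtain ⟨q, hq, hmin⟩ := Finset.exists_min_image (Finset.univ.filter P) u ⟨q0, by simp [hq0]⟩
      exact ⟨u q, fun p hp => hmin p (by simp [hp]), fun q' hq' => absurd ⟨q', hq'⟩ hQ⟩
    · exact ⟨0, fun p hp => absurd ⟨p, hp⟩ hP, fun p hp => absurd ⟨p, hp⟩ hQ⟩

/-- Farkas' lemma, proved by Fourier–Motzkin elimination. -/
theorem farkas_aux (n : ℕ) : ∀ (ι : Type) [Fintype ι] (A : ι → Fin n → ℝ) (b : ι → ℝ),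
    (∃ x : Fin n → ℝ, ∀ i, ∑ j, A i j * x j ≤ b i) ∨
    ∃ m : ι → ℝ, (∀ i, 0 ≤ m i) ∧ (∀ j, ∑ i, m i * A i j = 0) ∧ ∑ i, m i * b i < 0 := by
  induction n with
  | zero =>
    intro ι _ A b
    by_cases h : ∀ i, 0 ≤ b i
    · left; exact ⟨0, fun i => by simpa using h i⟩
    · right
      push Not at h
      obtain ⟨i, hi⟩ := h
      refine ⟨Pi.single i 1, fun i' => ?_, fun j => j.elim0, ?_⟩
      · by_cases h : i' = i
        · subst h; simp
        · simp [h]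
      · simpa [Pi.single_apply] using hi
  | succ n ih =>
    intro ι _ A b
    let M : ι ⊕ (ι × ι) → ι → ℝ := fun e => match e with
      | Sum.inl i => if A i 0 = 0 then Pi.single i 1 else 0
      | Sum.inr (p, q) => if 0 < A p 0 ∧ A q 0 < 0 then
          Pi.single p (-A q 0) + Pi.single q (A p 0) else 0
    have M0 : ∀ e i, 0 ≤ M e i := by
      rintro (i | ⟨p, q⟩) i'
      · simp only [M]; split_ifs
        · simp only [Pi.single_apply]; split_ifs <;> norm_num
        · simp
      · simp only [M]; split_ifs with h
        · simp only [Pi.single_apply, Pi.add_apply]; split_ifs <;> linarith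
        · simp
    have Msum : ∀ (g : ι → ℝ) (i : ι), A i 0 = 0 → ∑ i', M (Sum.inl i) i' * g i' = g i := by
      intro g i hi
      simp [M, hi, Pi.single_apply]
    have Msum2 : ∀ (g : ι → ℝ) (p q : ι), 0 < A p 0 → A q 0 < 0 →
        ∑ i', M (Sum.inr (p, q)) i' * g i' = -A q 0 * g p + A p 0 * g q := by
      intro g p q hp hq
      simp [M, hp, hq, Pi.single_apply, add_mul, Finset.sum_add_distrib]
    have Mz : ∀ e, ∑ i', M e i' * A i' 0 = 0 := by
      rintro (i | ⟨p, q⟩)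
      · by_cases h : A i 0 = 0
        · rw [Msum (fun i => A i 0) i h, h]
        · simp [M, h]
      · by_cases h : 0 < A p 0 ∧ A q 0 < 0
        · rw [Msum2 (fun i => A i 0) p q h.1 h.2]; ring
        · simp only [M, if_neg h]; simp
    rcases ih (ι ⊕ (ι × ι)) (fun e j => ∑ i, M e i * A i j.succ) (fun e => ∑ i, M e i * b i) with
      ⟨x, hx⟩ | ⟨m, hm0, hmA, hmb⟩
    · left
      have hx' : ∀ e, ∑ i, M e i * (∑ j, A i j.succ * x j) ≤ ∑ i, M e i * b i := by
        intro e
        refine le_trans (le_of_eq ?_) (hx e)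
        simp only [Finset.mul_sum, Finset.sum_mul]
        rw [Finset.sum_comm]
        simp only [mul_assoc]
      obtain ⟨x0, hp, hq⟩ := aux_between (fun p => 0 < A p 0) (fun q => A q 0 < 0)
        (fun i => (b i - ∑ j, A i j.succ * x j) / A i 0)
        (fun i => (b i - ∑ j, A i j.succ * x j) / A i 0) (by
          intro p q hp hq
          have := hx' (Sum.inr (p, q))
          rw [Msum2 (fun i => ∑ j, A i j.succ * x j) p q hp hq, Msum2 b p q hp hq] at this
          rw [le_div_iff₀ hp, div_mul_eq_mul_div, div_le_iff_of_neg hq]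
          nlinarith)
      refine ⟨Fin.cons x0 x, fun i => ?_⟩
      rw [Fin.sum_univ_succ]
      simp only [Fin.cons_zero, Fin.cons_succ]
      rcases lt_trichotomy (A i 0) 0 with h | h | h
      · have := hq i h
        rw [div_le_iff_of_neg h] at this
        linarith
      · have := hx' (Sum.inl i)
        rw [Msum (fun i => ∑ j, A i j.succ * x j) i h, Msum b i h] at this
        rw [h]; linarith
      · have := hp i h
        rw [le_div_iff₀ h] at this
        linarith
    · right
      have key : ∀ g : ι → ℝ, ∑ i, (∑ e, m e * M e i) * g i = ∑ e, m e * ∑ i, M e i * g i := by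
        intro g
        simp only [Finset.mul_sum, Finset.sum_mul]
        rw [Finset.sum_comm]
        simp only [mul_assoc]
      refine ⟨fun i => ∑ e, m e * M e i, fun i => Finset.sum_nonneg fun e _ =>
        mul_nonneg (hm0 e) (M0 e i), fun j => ?_, ?_⟩
      · rw [key (fun i => A i j)]
        refine Fin.cases ?_ (fun j => ?_) j
        · simp [Mz]
        · exact hmA j
      · rw [key b]; exact hmb

theorem lp_dual_aux {n : ℕ} {W : Type} [Fintype W] (p : W → Fin n → ℝ) (c μ : W → ℝ)
    (h0 : ∀ w, 0 ≤ μ w)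
    (hopt : ∀ μ' : W → ℝ, (∀ w, 0 ≤ μ' w) → ∑ w, μ' w = ∑ w, μ w →
      (∀ j, ∑ w, μ' w * p w j = ∑ w, μ w * p w j) → ∑ w, μ w * c w ≤ ∑ w, μ' w * c w) :
    ∃ (a : Fin n → ℝ) (b : ℝ), (∀ w, b ≤ c w + ∑ j, p w j * a j) ∧
      ∀ w, 0 < μ w → c w + ∑ j, p w j * a j = b := by
  let χ : W → ℝ := fun w => if 0 < μ w then 1 else 0
  let A : W ⊕ W → Fin (n + 1) → ℝ := fun e => match e with
    | Sum.inl w => Fin.cons 1 (fun j => - p w j)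
    | Sum.inr w => fun j => - χ w * (Fin.cons 1 (fun j => - p w j) : Fin (n + 1) → ℝ) j
  let b : W ⊕ W → ℝ := fun e => match e with
    | Sum.inl w => c w
    | Sum.inr w => - χ w * c w
  rcases farkas_aux (n + 1) (W ⊕ W) A b with ⟨x, hx⟩ | ⟨m, hm0, hmA, hmb⟩
  · have h1 : ∀ w, x 0 ≤ c w + ∑ j, p w j * x j.succ := by
      intro w
      have := hx (Sum.inl w)
      simp only [A, b, Fin.sum_univ_succ, Fin.cons_zero, Fin.cons_succ, neg_mul,
        Finset.sum_neg_distrib] at this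
      linarith
    refine ⟨fun j => x j.succ, x 0, h1, fun w hw => ?_⟩
    have := hx (Sum.inr w)
    simp only [A, b, χ, if_pos hw, Fin.sum_univ_succ, Fin.cons_zero, Fin.cons_succ, neg_mul, one_mul,
      neg_neg] at this
    linarith [h1 w]
  · exfalso
    let η : W → ℝ := fun w => m (Sum.inl w) - χ w * m (Sum.inr w)
    have hη0 : ∑ w, η w = 0 := by
      have := hmA 0
      simp only [A, Fintype.sum_sum_type, Fin.cons_zero] at this
      rw [← this, ← Finset.sum_add_distrib]
      refine Finset.sum_congr rfl fun w _ => ?_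
      simp only [η]; ring
    have hηp : ∀ j, ∑ w, η w * p w j = 0 := by
      intro j
      have := hmA j.succ
      simp only [A, Fintype.sum_sum_type, Fin.cons_succ] at this
      rw [← neg_eq_zero, ← this, ← Finset.sum_add_distrib, ← Finset.sum_neg_distrib]
      refine Finset.sum_congr rfl fun w _ => ?_
      simp only [η]; ring
    have hηc : ∑ w, η w * c w < 0 := by
      simp only [b, Fintype.sum_sum_type] at hmb
      rw [← Finset.sum_add_distrib] at hmb
      refine lt_of_eq_of_lt (Finset.sum_congr rfl fun w _ => ?_) hmb
      simp only [η]; ring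
    obtain ⟨ε, hε, hεpos⟩ : ∃ ε : ℝ, (∀ w, 0 ≤ μ w + ε * η w) ∧ 0 < ε := by
      have : ∀ᶠ ε in nhdsWithin (0 : ℝ) (Set.Ioi 0), (∀ w, 0 ≤ μ w + ε * η w) ∧ 0 < ε := by
        refine Filter.Eventually.and (Filter.eventually_all.2 fun w => ?_) self_mem_nhdsWithin
        by_cases hw : 0 < μ w
        · have hc : Filter.Tendsto (fun ε : ℝ => μ w + ε * η w) (nhdsWithin 0 (Set.Ioi 0))
              (nhds (μ w + 0 * η w)) := by
            refine Filter.Tendsto.mono_left ?_ nhdsWithin_le_nhds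
            exact (Continuous.tendsto (by fun_prop) 0)
          have := hc.eventually (lt_mem_nhds (a := 0) (by simpa using hw))
          exact this.mono fun _ h => h.le
        · filter_upwards [self_mem_nhdsWithin] with ε hε
          have : η w = m (Sum.inl w) := by simp [η, χ, hw]
          rw [this]
          exact add_nonneg (h0 w) (mul_nonneg (le_of_lt hε) (hm0 _))
      exact this.exists
    have key : ∀ g : W → ℝ, ∑ w, (μ w + ε * η w) * g w = ∑ w, μ w * g w + ε * ∑ w, η w * g w := by
      intro g
      rw [Finset.mul_sum, ← Finset.sum_add_distrib]
      exact Finset.sum_congr rfl fun w _ => by ring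
    have := hopt (fun w => μ w + ε * η w) hε
      (by rw [Finset.sum_add_distrib, ← Finset.mul_sum, hη0]; ring)
      (fun j => by rw [key (fun w => p w j), hηp]; ring)
    rw [key c] at this
    nlinarith

theorem carath_aux {n : ℕ} {W : Type} [Fintype W] (p : W → Fin n → ℝ) (μ : W → ℝ)
    (h0 : ∀ w, 0 ≤ μ w) (hs : ∑ w, μ w = (n : ℝ) + 2) :
    ∃ ν : W → ℝ, (∀ w, 0 ≤ ν w) ∧ ∑ w, ν w = (n : ℝ) + 2 ∧
      (∀ j, ∑ w, ν w * p w j = ∑ w, μ w * p w j) ∧ (∀ w, μ w = 0 → ν w = 0) ∧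
      ∃ w, 1 < ν w := by
  have hspos : (0 : ℝ) < (n : ℝ) + 2 := by positivity
  let S : Set (Fin n → ℝ) := {q | ∃ w, μ w ≠ 0 ∧ p w = q}
  have hmem : ∑ w ∈ Finset.univ.filter (fun w => μ w ≠ 0), (μ w / (n + 2)) • p w ∈
      convexHull ℝ S := by
    refine (convex_convexHull ℝ S).sum_mem (fun w _ => div_nonneg (h0 w) hspos.le) ?_ ?_
    · rw [← Finset.sum_div, Finset.sum_filter_ne_zero, hs, div_self hspos.ne']
    · intro w hw
      exact subset_convexHull ℝ S ⟨w, by simpa using hw, rfl⟩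
  obtain ⟨ι, _, z, t, hz, hind, ht0, ht1, htz⟩ := eq_pos_convex_span_of_mem_convexHull hmem
  have hcard : Fintype.card ι ≤ n + 1 := by
    have := hind.card_le_finrank_succ
    refine this.trans ?_
    have h2 := Submodule.finrank_le (vectorSpan ℝ (Set.range z))
    simp at h2
    omega
  choose g hg1 hg2 using fun i => hz (Set.mem_range_self i)
  have htz' : ∀ j, ∑ i, ((n : ℝ) + 2) * t i * p (g i) j = ∑ w, μ w * p w j := by
    intro j
    have h3 := congrFun htz j
    simp only [Finset.sum_apply, Pi.smul_apply, smul_eq_mul] at h3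
    have h4 : ∑ w ∈ Finset.univ.filter (fun w => μ w ≠ 0), μ w / ((n : ℝ) + 2) * p w j
        = ∑ w, μ w / ((n : ℝ) + 2) * p w j := by
      refine Finset.sum_subset (Finset.filter_subset _ _) fun w _ hw => ?_
      have : μ w = 0 := by simpa using hw
      simp [this]
    rw [h4] at h3
    simp only [hg2]
    simp only [mul_assoc]
    rw [← Finset.mul_sum, h3, Finset.mul_sum]
    refine Finset.sum_congr rfl fun w _ => ?_
    field_simp
  have key : ∀ f : W → ℝ, ∑ w, (∑ i, if g i = w then ((n : ℝ) + 2) * t i else 0) * f w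
      = ∑ i, ((n : ℝ) + 2) * t i * f (g i) := by
    intro f
    simp only [Finset.sum_mul]
    rw [Finset.sum_comm]
    refine Finset.sum_congr rfl fun i _ => ?_
    simp
  have hterm : ∀ w i, 0 ≤ (if g i = w then ((n : ℝ) + 2) * t i else 0) := by
    intro w i
    split_ifs
    · exact mul_nonneg hspos.le (ht0 i).le
    · exact le_rfl
  refine ⟨fun w => ∑ i, if g i = w then ((n : ℝ) + 2) * t i else 0,
    fun w => Finset.sum_nonneg fun i _ => hterm w i, ?_, fun j => ?_, fun w hw => ?_, ?_⟩
  · have := key (fun _ => 1)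
    simp only [mul_one] at this
    rw [this, ← Finset.mul_sum, ht1, mul_one]
  · rw [key (fun w => p w j)]; exact htz' j
  · refine Finset.sum_eq_zero fun i _ => ?_
    rw [if_neg]
    rintro rfl
    exact hg1 i hw
  · have hex : ∃ i, 1 < ((n : ℝ) + 2) * t i := by
      by_contra hcon
      push Not at hcon
      have h5 : ∑ i, ((n : ℝ) + 2) * t i ≤ ∑ i : ι, (1 : ℝ) :=
        Finset.sum_le_sum fun i _ => hcon i
      rw [← Finset.mul_sum, ht1] at h5
      simp at h5
      have : (Fintype.card ι : ℝ) ≤ n + 1 := by exact_mod_cast hcard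
      linarith
    obtain ⟨i, hi⟩ := hex
    refine ⟨g i, lt_of_lt_of_le hi ?_⟩
    have := Finset.single_le_sum (f := fun i' => if g i' = g i then ((n : ℝ) + 2) * t i' else 0)
      (fun i' _ => hterm (g i) i') (Finset.mem_univ i)
    simpa using this

theorem sum_ite_aux {W : Type} [Fintype W] (v : W) (g : W → ℝ) [∀ x, Decidable (x = v)] :
    ∑ x, (if x = v then g x else 0) = g v := by
  rw [Finset.sum_eq_single v]
  · simp
  · intro b _ hb
    simp [hb]
  · intro h
    exact absurd (Finset.mem_univ v) h

theorem sum_update_aux {k : ℕ} {X : Fin k → Type} (h : ∀ j, X j → ℝ) (w : ∀ j, X j)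
    (j : Fin k) (v : X j) :
    ∑ j', h j' (Function.update w j v j') = ∑ j', h j' (w j') + (h j v - h j (w j)) := by
  rw [← Finset.add_sum_erase Finset.univ _ (Finset.mem_univ j),
    ← Finset.add_sum_erase Finset.univ (fun j' => h j' (w j')) (Finset.mem_univ j)]
  have : ∑ x ∈ Finset.univ.erase j, h x (Function.update w j v x)
      = ∑ x ∈ Finset.univ.erase j, h x (w x) := by
    refine Finset.sum_congr rfl fun x hx => ?_
    rw [Function.update_of_ne (Finset.ne_of_mem_erase hx)]
  rw [this]
  simp only [Function.update_self]
  ring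

theorem expDeg_le_deg {n : ℕ} (f : TropPoly n) {I : Exp n} (hI : I ∈ f.supp) :
    expDeg I ≤ f.deg := Finset.le_sup hI

theorem lp_min_aux {n : ℕ} {W : Type} [Fintype W] (p : W → Fin n → ℝ) (c : W → ℝ) (s : ℝ)
    (x : Fin n → ℝ)
    (hne : ∃ μ : W → ℝ, (∀ w, 0 ≤ μ w) ∧ ∑ w, μ w = s ∧ ∀ i, ∑ w, μ w * p w i = x i) :
    ∃ μ : W → ℝ, ((∀ w, 0 ≤ μ w) ∧ ∑ w, μ w = s ∧ ∀ i, ∑ w, μ w * p w i = x i) ∧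
      ∀ μ' : W → ℝ, ((∀ w, 0 ≤ μ' w) ∧ ∑ w, μ' w = s ∧ ∀ i, ∑ w, μ' w * p w i = x i) →
        ∑ w, μ w * c w ≤ ∑ w, μ' w * c w := by
  let S : Set (W → ℝ) := {μ | (∀ w, 0 ≤ μ w) ∧ ∑ w, μ w = s ∧ ∀ i, ∑ w, μ w * p w i = x i}
  have hcl : IsClosed S := by
    have e : S = (⋂ w, {μ : W → ℝ | 0 ≤ μ w}) ∩ ({μ : W → ℝ | ∑ w, μ w = s} ∩
        ⋂ i, {μ : W → ℝ | ∑ w, μ w * p w i = x i}) := by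
      ext μ; simp [S]
    rw [e]
    refine (isClosed_iInter fun w => isClosed_le (by fun_prop) (by fun_prop)).inter
      ((isClosed_eq (by fun_prop) (by fun_prop)).inter
        (isClosed_iInter fun i => isClosed_eq (by fun_prop) (by fun_prop)))
  have hcomp : IsCompact S := by
    refine (isCompact_Icc (a := (0 : W → ℝ)) (b := fun _ => s)).of_isClosed_subset hcl ?_
    rintro μ ⟨h0, h1, -⟩
    refine ⟨fun w => h0 w, fun w => ?_⟩
    rw [← h1]
    exact Finset.single_le_sum (fun w _ => h0 w) (Finset.mem_univ w)
  obtain ⟨μ, hμ, hmin⟩ := hcomp.exists_isMinOn hne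
    (f := fun μ : W → ℝ => ∑ w, μ w * c w) (by fun_prop)
  exact ⟨μ, hμ, fun μ' h' => hmin h'⟩

theorem dual_null_aux (n k : ℕ) (F : Fin k → TropPoly n) (y : Exp n → ℝ)
    (hy : ∀ (j : Fin k) (J : Exp n), expDeg J + (F j).deg ≤ (n + 2) * ∑ j, (F j).deg →
      ∃ I ∈ (F j).supp, ∃ I' ∈ (F j).supp, I ≠ I' ∧ ∀ K ∈ (F j).supp,
        (F j).coeff I + y (I + J) ≤ (F j).coeff K + y (K + J) ∧
        (F j).coeff I' + y (I' + J) ≤ (F j).coeff K + y (K + J)) :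
    ∃ a : Fin n → ℝ, ∀ j, (F j).IsRoot a := by
  set D : ℕ := ∑ j, (F j).deg with hD
  let W : Type := ∀ j : Fin k, {I // I ∈ (F j).supp}
  let p : W → Fin n → ℝ := fun w i => ∑ j, ((w j).1 i : ℝ)
  let c : W → ℝ := fun w => ∑ j, (F j).coeff (w j).1
  let Feas : Exp n → (W → ℝ) → Prop := fun x μ =>
    (∀ w, 0 ≤ μ w) ∧ ∑ w, μ w = (n : ℝ) + 2 ∧ ∀ i, ∑ w, μ w * p w i = (x i : ℝ)
  let V : Exp n → (W → ℝ) → ℝ := fun x μ => ∑ w, μ w * c w + y x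
  have hp0 : ∀ w i, 0 ≤ p w i := fun w i => Finset.sum_nonneg fun j _ => Nat.cast_nonneg _
  have hP : ∀ w, ∑ i, p w i = ∑ j, (expDeg (w j).1 : ℝ) := by
    intro w
    simp only [p]
    rw [Finset.sum_comm]
    simp [expDeg]
  have hPD : ∀ w, ∑ i, p w i ≤ D := by
    intro w
    rw [hP, hD]
    push_cast
    exact Finset.sum_le_sum fun j _ => by exact_mod_cast expDeg_le_deg (F j) (w j).2
  -- finiteness of the set of feasible lattice points
  have hfin : {x : Exp n | ∃ μ, Feas x μ}.Finite := by
    refine (Set.finite_Iic (fun _ : Fin n => (n + 2) * D)).subset ?_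
    rintro x ⟨μ, h0, h1, h2⟩ i
    have : (x i : ℝ) ≤ ((n : ℝ) + 2) * D := by
      rw [← h2 i, ← h1, Finset.sum_mul]
      refine Finset.sum_le_sum fun w _ => mul_le_mul_of_nonneg_left ?_ (h0 w)
      exact (Finset.single_le_sum (fun i _ => hp0 w i) (Finset.mem_univ i)).trans (hPD w)
    exact_mod_cast this
  have hne : {x : Exp n | ∃ μ, Feas x μ}.Nonempty := by
    let w : W := fun j => ⟨(F j).supp_nonempty.choose, (F j).supp_nonempty.choose_spec⟩
    refine ⟨fun i => (n + 2) * ∑ j, (w j).1 i, fun w' => if w' = w then (n : ℝ) + 2 else 0, ?_, ?_, ?_⟩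
    · intro w'
      dsimp only
      split_ifs <;> positivity
    · exact sum_ite_aux w (fun _ => (n : ℝ) + 2)
    · intro i
      simp only [ite_mul, zero_mul]
      rw [sum_ite_aux w (fun x => ((n : ℝ) + 2) * p x i)]
      simp [p]
  have hbest : ∀ x : Exp n, ∃ μ, (∃ μ, Feas x μ) → Feas x μ ∧
      ∀ μ', Feas x μ' → ∑ w, μ w * c w ≤ ∑ w, μ' w * c w := by
    intro x
    by_cases h : ∃ μ, Feas x μ
    · obtain ⟨μ, h1, h2⟩ := lp_min_aux p c ((n : ℝ) + 2) (fun i => (x i : ℝ)) h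
      exact ⟨μ, fun _ => ⟨h1, h2⟩⟩
    · exact ⟨0, fun h' => absurd h' h⟩
  choose best hb using hbest
  obtain ⟨x1, hx1, hx1min⟩ := Set.exists_min_image _ (fun x => V x (best x)) hfin hne
  have hVmin : ∀ x μ, Feas x μ → V x1 (best x1) ≤ V x μ := by
    intro x μ h
    refine (hx1min x ⟨μ, h⟩).trans ?_
    exact add_le_add_left ((hb x ⟨μ, h⟩).2 μ h) _
  set V0 := V x1 (best x1) with hV0
  -- choose a minimizer with maximal support
  let T : Set (Finset W) := {G | ∃ x μ, Feas x μ ∧ V x μ = V0 ∧ G = Finset.univ.filter (fun w => 0 < μ w)}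
  have hTne : T.Nonempty := ⟨_, x1, best x1, (hb x1 hx1).1, rfl, rfl⟩
  obtain ⟨G, hG⟩ := (Set.toFinite T).exists_maximal hTne
  obtain ⟨x0, μ, hμ, hμV, hGμ⟩ := hG.prop
  obtain ⟨hμ0, hμ1, hμ2⟩ := hμ
  obtain ⟨a, b, hab, habeq⟩ := lp_dual_aux p c μ hμ0 (by
    intro μ' h0 h1 h2
    have := hVmin x0 μ' ⟨h0, h1.trans hμ1, fun i => (h2 i).trans (hμ2 i)⟩
    rw [← hμV] at this
    simp only [V] at this
    linarith)
  obtain ⟨ν, hν0, hν1, hν2, hνμ, w, hw⟩ := carath_aux p μ hμ0 hμ1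
  have hcost : ∀ κ : W → ℝ, (∀ w, μ w = 0 → κ w = 0) →
      ∑ w, κ w * c w = (∑ w, κ w) * b - ∑ i, (∑ w, κ w * p w i) * a i := by
    intro κ hκ
    have : ∀ w, κ w * c w = κ w * b - ∑ i, κ w * p w i * a i := by
      intro w
      by_cases h : μ w = 0
      · simp [hκ w h]
      · have h2 := habeq w (lt_of_le_of_ne (hμ0 w) (Ne.symm h))
        have h3 : ∑ i, κ w * p w i * a i = κ w * ∑ i, p w i * a i := by
          rw [Finset.mul_sum]; simp only [mul_assoc]
        rw [h3, ← h2]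
        ring
    rw [Finset.sum_congr rfl fun w _ => this w, Finset.sum_sub_distrib, Finset.sum_mul]
    congr 1
    rw [Finset.sum_comm]
    simp only [Finset.sum_mul]
  have hνc : ∑ w, ν w * c w = ∑ w, μ w * c w := by
    rw [hcost ν hνμ, hcost μ (fun _ h => h), hν1, hμ1]
    simp only [hν2]
  -- mix the two
  obtain ⟨ε, hε0, hε1, hεw⟩ : ∃ ε : ℝ, 0 < ε ∧ ε < 1 ∧ 1 < (1 - ε) * ν w := by
    refine ⟨(ν w - 1) / (2 * ν w), ?_, ?_, ?_⟩
    · apply div_pos <;> linarith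
    · rw [div_lt_one (by linarith)]; linarith
    · have : (1 - (ν w - 1) / (2 * ν w)) * ν w = (ν w + 1) / 2 := by
        field_simp; ring
      rw [this]; linarith
  let m : W → ℝ := fun w => (1 - ε) * ν w + ε * μ w
  have hmsum : ∀ g : W → ℝ, ∑ w, m w * g w =
      (1 - ε) * ∑ w, ν w * g w + ε * ∑ w, μ w * g w := by
    intro g
    rw [Finset.mul_sum, Finset.mul_sum, ← Finset.sum_add_distrib]
    exact Finset.sum_congr rfl fun w _ => by simp only [m]; ring
  have hm0 : ∀ w, 0 ≤ m w := fun w =>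
    add_nonneg (mul_nonneg (by linarith) (hν0 w)) (mul_nonneg hε0.le (hμ0 w))
  have hm1 : ∑ w, m w = (n : ℝ) + 2 := by
    have := hmsum (fun _ => 1)
    simp only [mul_one] at this
    rw [this, hν1, hμ1]; ring
  have hm2 : ∀ i, ∑ w, m w * p w i = (x0 i : ℝ) := by
    intro i
    rw [hmsum (fun w => p w i), hν2, hμ2]; ring
  have hmc : ∑ w, m w * c w = ∑ w, μ w * c w := by
    rw [hmsum c, hνc]; ring
  have hmG : ∀ w ∈ G, 0 < m w := by
    intro w' hw'
    rw [hGμ] at hw'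
    have : 0 < μ w' := by simpa using hw'
    have := mul_pos hε0 this
    have := mul_nonneg (by linarith : (0 : ℝ) ≤ 1 - ε) (hν0 w')
    simp only [m]; linarith
  have hmw : 1 < m w := by
    have := mul_nonneg hε0.le (hμ0 w)
    simp only [m]; linarith
  -- `x0 ≥ p w`
  have hxw : ∀ i, p w i ≤ x0 i := by
    intro i
    rw [← hm2 i]
    have := Finset.single_le_sum (f := fun w => m w * p w i)
      (fun w _ => mul_nonneg (hm0 w) (hp0 w i)) (Finset.mem_univ w)
    refine le_trans ?_ this
    have := hp0 w i
    nlinarith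
  have hwx : ∀ j, (w j).1 ≤ x0 := by
    intro j i
    have h1 : ((w j).1 i : ℝ) ≤ p w i :=
      Finset.single_le_sum (f := fun j => ((w j).1 i : ℝ)) (fun j _ => Nat.cast_nonneg _)
        (Finset.mem_univ j)
    exact_mod_cast h1.trans (hxw i)
  have hxsum : (expDeg x0 : ℝ) ≤ ((n : ℝ) + 1) * D + ∑ i, p w i := by
    have h1 : (expDeg x0 : ℝ) = ∑ w', m w' * ∑ i, p w' i := by
      simp only [expDeg, Nat.cast_sum, Finset.mul_sum]
      rw [Finset.sum_comm]
      exact Finset.sum_congr rfl fun i _ => (hm2 i).symm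
    have h2 : ∀ w', m w' * ∑ i, p w' i ≤ m w' * D - (if w' = w then D - ∑ i, p w i else 0) := by
      intro w'
      have := hPD w'
      split_ifs with h
      · subst h; nlinarith
      · have := mul_le_mul_of_nonneg_left this (hm0 w')
        linarith
    rw [h1]
    refine (Finset.sum_le_sum fun w' _ => h2 w').trans ?_
    rw [Finset.sum_sub_distrib, ← Finset.sum_mul, hm1, sum_ite_aux w (fun _ => (D : ℝ) - ∑ i, p w i)]
    linarith
  -- exchange
  have hexch : ∀ (j : Fin k) (I : {I // I ∈ (F j).supp}),
      (F j).coeff I.1 + y (I.1 + (x0 - (w j).1)) ≤ (F j).coeff (w j).1 + y x0 →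
      Function.update w j I ∈ G := by
    intro j I hI
    let w' : W := Function.update w j I
    let m' : W → ℝ := fun v => m v + (if v = w' then 1 else 0) - (if v = w then 1 else 0)
    have hs : ∀ g : W → ℝ, ∑ v, m' v * g v = ∑ v, m v * g v + (g w' - g w) := by
      intro g
      have : ∀ v, m' v * g v = m v * g v + (if v = w' then g v else 0) - (if v = w then g v else 0) := by
        intro v; simp only [m']; split_ifs <;> ring
      rw [Finset.sum_congr rfl fun v _ => this v, Finset.sum_sub_distrib, Finset.sum_add_distrib,
        sum_ite_aux w' g, sum_ite_aux w g]
      ring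
    have hw'G : ∀ v, v ∈ G ∨ v = w' → 0 < m' v := by
      intro v hv
      simp only [m']
      have h1 := hm0 v
      by_cases e1 : v = w
      · subst e1
        split_ifs <;> linarith
      · rcases hv with hv | hv
        · have := hmG v hv
          rw [if_neg e1]
          split_ifs <;> linarith
        · rw [if_neg e1, if_pos hv]; linarith
    have hm'0 : ∀ v, 0 ≤ m' v := by
      intro v
      simp only [m']
      have h1 := hm0 v
      by_cases e1 : v = w
      · subst e1
        split_ifs <;> linarith
      · rw [if_neg e1]
        split_ifs <;> linarith
    have hFeas : Feas (I.1 + (x0 - (w j).1)) m' := by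
      refine ⟨hm'0, ?_, fun i => ?_⟩
      · have := hs (fun _ => 1)
        simp only [mul_one, sub_self, add_zero] at this
        rw [this, hm1]
      · rw [hs (fun v => p v i), hm2]
        have h2 := sum_update_aux (X := fun j => {I // I ∈ (F j).supp})
          (fun j I => (I.1 i : ℝ)) w j I
        have h3 : p w' i = p w i + ((I.1 i : ℝ) - ((w j).1 i : ℝ)) := h2
        rw [h3]
        simp only [Pi.add_apply, Pi.sub_apply]
        push_cast [Nat.cast_sub (hwx j i)]
        ring
    have hVm : V (I.1 + (x0 - (w j).1)) m' = V0 := by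
      refine le_antisymm ?_ (hVmin _ _ hFeas)
      rw [← hμV]
      simp only [V]
      rw [hs c, hmc]
      have h2 := sum_update_aux (X := fun j => {I // I ∈ (F j).supp})
          (fun j I => (F j).coeff I.1) w j I
      have h3 : c w' = c w + ((F j).coeff I.1 - (F j).coeff (w j).1) := h2
      rw [h3]
      linarith
    have hT' : Finset.univ.filter (fun v => 0 < m' v) ∈ T := ⟨_, m', hFeas, hVm, rfl⟩
    have hle : G ≤ Finset.univ.filter (fun v => 0 < m' v) := by
      intro v hv
      simpa using hw'G v (Or.inl hv)
    have := hG.le_of_ge hT' hle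
    exact this (by simpa using hw'G w' (Or.inr rfl))
  have hGpos : ∀ v ∈ G, 0 < μ v := by
    intro v hv
    rw [hGμ] at hv
    simpa using hv
  have hq : ∀ v : W, c v + ∑ i, p v i * a i = ∑ j, (F j).mono (v j).1 a := by
    intro v
    simp only [c, p, TropPoly.mono, Finset.sum_add_distrib, Finset.sum_mul]
    rw [Finset.sum_comm]
  have hqu : ∀ j (I : {I // I ∈ (F j).supp}), ∑ j', (F j').mono (Function.update w j I j').1 a =
      ∑ j', (F j').mono (w j').1 a + ((F j).mono I.1 a - (F j).mono (w j).1 a) := fun j I =>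
    sum_update_aux (X := fun j => {I // I ∈ (F j).supp}) (fun j I => (F j).mono I.1 a) w j I
  have hwG : 0 < μ w := by
    refine lt_of_le_of_ne (hμ0 w) fun h => ?_
    have := hνμ w h.symm
    linarith
  have hwb := habeq w hwG
  rw [hq] at hwb
  refine ⟨a, fun j => ?_⟩
  have hmin : ∀ K ∈ (F j).supp, (F j).mono (w j).1 a ≤ (F j).mono K a := by
    intro K hK
    have := hab (Function.update w j ⟨K, hK⟩)
    rw [hq, hqu, hwb] at this
    simp only at this
    linarith
  have heval : (F j).mono (w j).1 a = (F j).eval a := by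
    refine le_antisymm (Finset.le_inf' _ _ hmin) (Finset.inf'_le _ (w j).2)
  have hJ : expDeg (x0 - (w j).1) + (F j).deg ≤ (n + 2) * D := by
    have h1 : (expDeg (x0 - (w j).1) : ℝ) = expDeg x0 - expDeg (w j).1 := by
      simp only [expDeg, Nat.cast_sum, ← Finset.sum_sub_distrib, Pi.sub_apply]
      exact Finset.sum_congr rfl fun i _ => Nat.cast_sub (hwx j i)
    have h2 : ∑ i, p w i - expDeg (w j).1 ≤ (D : ℝ) - (F j).deg := by
      rw [hP, hD]
      push_cast
      rw [← Finset.add_sum_erase Finset.univ (fun j => (expDeg (w j).1 : ℝ)) (Finset.mem_univ j),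
        ← Finset.add_sum_erase Finset.univ (fun j => ((F j).deg : ℝ)) (Finset.mem_univ j)]
      have := Finset.sum_le_sum (s := Finset.univ.erase j) (f := fun j => (expDeg (w j).1 : ℝ))
        (g := fun j => ((F j).deg : ℝ)) fun j _ => by exact_mod_cast expDeg_le_deg (F j) (w j).2
      linarith
    have : ((expDeg (x0 - (w j).1) : ℝ)) + (F j).deg ≤ ((n : ℝ) + 2) * D := by
      rw [h1]; linarith
    exact_mod_cast this
  obtain ⟨I1, hI1, I2, hI2, hne12, hI⟩ := hy j _ hJ
  have hwJ : (w j).1 + (x0 - (w j).1) = x0 := by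
    funext i
    have : (w j).1 i ≤ x0 i := hwx j i
    simp only [Pi.add_apply, Pi.sub_apply]
    exact Nat.add_sub_cancel' this
  have hIw := hI (w j).1 (w j).2
  rw [hwJ] at hIw
  obtain ⟨I, hIs, hIne, hIle⟩ : ∃ I, ∃ hIs : I ∈ (F j).supp, I ≠ (w j).1 ∧
      (F j).coeff I + y (I + (x0 - (w j).1)) ≤ (F j).coeff (w j).1 + y x0 := by
    by_cases h : I1 = (w j).1
    · exact ⟨I2, hI2, fun h' => hne12 (h.trans h'.symm), hIw.2⟩
    · exact ⟨I1, hI1, h, hIw.1⟩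
  have hfin := habeq _ (hGpos _ (hexch j ⟨I, hIs⟩ hIle))
  rw [hq, hqu, hwb] at hfin
  simp only at hfin
  exact ⟨(w j).1, (w j).2, I, hIs, hIne.symm, heval, by rw [← heval]; linarith⟩

/-- Discounted super-solutions. -/
def DiscSol {R C : Type} (supp : R → Finset C) (a : R → C → ℝ) (r : ℝ) (y : C → ℝ) : Prop :=
  ∀ l, ∀ I ∈ supp l, ∃ I' ∈ supp l, I' ≠ I ∧ a l I' + r * y I' ≤ a l I + y I

theorem discSol_closed {R C : Type} (supp : R → Finset C) (a : R → C → ℝ) :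
    IsClosed {q : ℝ × (C → ℝ) | DiscSol supp a q.1 q.2} := by
  have e : {q : ℝ × (C → ℝ) | DiscSol supp a q.1 q.2} =
      ⋂ l, ⋂ I, ⋂ (_ : I ∈ supp l), ⋃ I' ∈ (supp l).filter (fun I' => I' ≠ I),
        {q : ℝ × (C → ℝ) | a l I' + q.1 * q.2 I' ≤ a l I + q.2 I} := by
    ext q
    simp [DiscSol, and_assoc]
  rw [e]
  refine isClosed_iInter fun l => isClosed_iInter fun I => isClosed_iInter fun _ => ?_
  refine isClosed_biUnion_finset fun I' _ => isClosed_le ?_ ?_ <;> fun_prop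

theorem disc_aux {R C : Type} [Fintype R] [Fintype C] (supp : R → Finset C) (a : R → C → ℝ)
    (hs : ∀ l, ∀ I ∈ supp l, ∃ I' ∈ supp l, I' ≠ I) (D : ℝ) (hD : 0 < D)
    (hDa : ∀ l I I', a l I' - a l I ≤ D) (r : ℝ) (hr0 : 0 ≤ r) (hr1 : r < 1) :
    ∃ y : C → ℝ, (∀ I, 0 ≤ y I) ∧ DiscSol supp a r y ∧
      ∀ I, 0 < y I → ∃ l, I ∈ supp l ∧ ∀ I' ∈ supp l, I' ≠ I → a l I + y I ≤ a l I' + r * y I' := by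
  have h1r : 0 < 1 - r := by linarith
  set B : ℝ := D / (1 - r) with hB
  have hB0 : 0 < B := div_pos hD h1r
  have hBr : B * (1 - r) = D := div_mul_cancel₀ _ h1r.ne'
  let S : Set (C → ℝ) := Set.Icc 0 (fun _ => B) ∩ {y | DiscSol supp a r y}
  have hScl : IsCompact S := by
    refine isCompact_Icc.inter_right ?_
    exact (discSol_closed supp a).preimage (f := fun y : C → ℝ => (r, y)) (by fun_prop)
  have hSne : S.Nonempty := by
    refine ⟨fun _ => B, ⟨fun _ => hB0.le, fun _ => le_rfl⟩, fun l I hI => ?_⟩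
    obtain ⟨I', hI', hne⟩ := hs l I hI
    exact ⟨I', hI', hne, by have := hDa l I I'; nlinarith⟩
  obtain ⟨y, hy, hmin⟩ := hScl.exists_isMinOn hSne (f := fun y : C → ℝ => ∑ I, y I) (by fun_prop)
  refine ⟨y, fun I => hy.1.1 I, hy.2, fun I hI => ?_⟩
  by_contra hcon
  push Not at hcon
  obtain ⟨δ, ⟨hδl, hδy⟩, hδ0⟩ : ∃ δ : ℝ, ((∀ l, I ∈ supp l → ∃ I' ∈ supp l, I' ≠ I ∧
      a l I' + r * y I' ≤ a l I + (y I - δ)) ∧ 0 ≤ y I - δ) ∧ 0 < δ := by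
    have : ∀ᶠ δ in nhdsWithin (0 : ℝ) (Set.Ioi 0), ((∀ l, I ∈ supp l → ∃ I' ∈ supp l, I' ≠ I ∧
      a l I' + r * y I' ≤ a l I + (y I - δ)) ∧ 0 ≤ y I - δ) ∧ 0 < δ := by
      have small : ∀ t : ℝ, 0 < t → ∀ᶠ δ in nhdsWithin (0 : ℝ) (Set.Ioi 0), δ < t := fun t ht =>
        nhdsWithin_le_nhds (gt_mem_nhds ht)
      refine Filter.Eventually.and (Filter.Eventually.and (Filter.eventually_all.2 fun l => ?_) ?_)
        self_mem_nhdsWithin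
      · by_cases hl : I ∈ supp l
        · obtain ⟨I', hI', hne, hlt⟩ := hcon l hl
          filter_upwards [small (a l I + y I - (a l I' + r * y I')) (by linarith)] with δ hδ _
          exact ⟨I', hI', hne, by linarith⟩
        · exact Filter.Eventually.of_forall fun _ h => absurd h hl
      · filter_upwards [small (y I) hI] with δ hδ
        linarith
    exact this.exists
  have hle : ∀ I0, Function.update y I (y I - δ) I0 ≤ y I0 := by
    intro I0
    by_cases h : I0 = I
    · subst h; simp [hδ0.le]
    · simp [h]
  have hmem : Function.update y I (y I - δ) ∈ S := by
    refine ⟨⟨fun I0 => ?_, fun I0 => (hle I0).trans (hy.1.2 I0)⟩, fun l I0 hI0 => ?_⟩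
    · by_cases h : I0 = I
      · subst h; simpa using hδy
      · simpa [h] using hy.1.1 I0
    · by_cases h : I0 = I
      · subst h
        obtain ⟨I', hI', hne, hh⟩ := hδl l hI0
        refine ⟨I', hI', hne, ?_⟩
        rw [Function.update_self, Function.update_of_ne hne]
        exact hh
      · obtain ⟨I', hI', hne, hh⟩ := hy.2 l I0 hI0
        refine ⟨I', hI', hne, ?_⟩
        rw [Function.update_of_ne h]
        have := mul_le_mul_of_nonneg_left (hle I') hr0
        linarith
  have h1 : ∑ J, y J ≤ ∑ J, Function.update y I (y I - δ) J := hmin hmem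
  have h2 : ∑ J, Function.update y I (y I - δ) J < ∑ J, y J :=
    Finset.sum_lt_sum (fun J _ => hle J) ⟨I, Finset.mem_univ I, by simpa using hδ0⟩
  linarith

theorem gap_aux {C : Type} [Fintype C] (y : C → ℝ) (D : ℝ) (hD : 0 < D) :
    ∃ j : ℕ, j ≤ Fintype.card C ∧ ∀ I, (j : ℝ) * D < y I → ((j : ℝ) + 1) * D < y I := by
  by_contra hcon
  push Not at hcon
  choose g hg1 hg2 using fun j : Fin (Fintype.card C + 1) => hcon j.1 (Nat.lt_succ_iff.1 j.2)
  have hinj : Function.Injective g := by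
    have key : ∀ i j : Fin (Fintype.card C + 1), i < j → g i ≠ g j := by
      intro i j hij h
      have h1 := hg2 i
      have h2 := hg1 j
      rw [h] at h1
      have h3 : ((i : ℕ) : ℝ) + 1 ≤ (j : ℕ) := by exact_mod_cast hij
      nlinarith
    intro i j h
    rcases lt_trichotomy i j with h' | h' | h'
    · exact absurd h (key i j h')
    · exact h'
    · exact absurd h.symm (key j i h')
  have := Fintype.card_le_of_injective g hinj
  simp at this

theorem duality_aux {R C : Type} [Fintype R] [Fintype C] (supp : R → Finset C) (a : R → C → ℝ)
    (hne : ∀ l, (supp l).Nonempty) :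
    (∃ y : C → ℝ, ∀ l, ∃ I ∈ supp l, ∃ I' ∈ supp l, I ≠ I' ∧ ∀ K ∈ supp l,
      a l I + y I ≤ a l K + y K ∧ a l I' + y I' ≤ a l K + y K) ∨
    ∃ (C' : Finset C) (y : C → ℝ), C'.Nonempty ∧ ∀ I ∈ C', ∃ l, I ∈ supp l ∧ supp l ⊆ C' ∧
      ∀ I' ∈ supp l, I' ≠ I → a l I + y I < a l I' + y I' := by
  by_cases hs : ∀ l, ∀ I ∈ supp l, ∃ I' ∈ supp l, I' ≠ I
  swap
  · right
    push Not at hs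
    obtain ⟨l, I, hI, h⟩ := hs
    refine ⟨{I}, 0, Finset.singleton_nonempty I, fun I0 hI0 => ?_⟩
    rw [Finset.mem_singleton] at hI0
    subst hI0
    exact ⟨l, hI, fun I' hI' => by simpa using h I' hI', fun I' hI' hn => absurd (h I' hI') hn⟩
  obtain ⟨D, hD, hDa⟩ : ∃ D : ℝ, 0 < D ∧ ∀ l I I', a l I' - a l I ≤ D := by
    obtain ⟨D, hD⟩ := (Set.finite_range (fun q : R × C × C => a q.1 q.2.2 - a q.1 q.2.1)).bddAbove
    refine ⟨max D 1, by positivity, fun l I I' => le_trans ?_ (le_max_left _ _)⟩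
    exact hD ⟨(l, I, I'), rfl⟩
  by_cases hbig : ∃ r : ℝ, 0 ≤ r ∧ r < 1 ∧ ∃ y : C → ℝ, (∀ I, 0 ≤ y I) ∧
      (∀ I, 0 < y I → ∃ l, I ∈ supp l ∧ ∀ I' ∈ supp l, I' ≠ I → a l I + y I ≤ a l I' + r * y I') ∧
      ∃ I, ((Fintype.card C : ℝ) + 1) * D < y I
  · right
    obtain ⟨r, hr0, hr1, y, hy0, hy, I0, hI0⟩ := hbig
    obtain ⟨j, hj, hgap⟩ := gap_aux y D hD
    have hjc : (j : ℝ) ≤ Fintype.card C := by exact_mod_cast hj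
    have hj0 : (0 : ℝ) ≤ j * D := by positivity
    refine ⟨Finset.univ.filter (fun I => (j : ℝ) * D < y I), y, ⟨I0, ?_⟩, fun I hI => ?_⟩
    · simp only [Finset.mem_filter, Finset.mem_univ, true_and]
      nlinarith
    · have hI : (j : ℝ) * D < y I := by simpa using hI
      have hI2 := hgap I hI
      obtain ⟨l, hl, hh⟩ := hy I (by linarith)
      have hbd : ∀ I' ∈ supp l, (j : ℝ) * D < y I' := by
        intro I' hI'
        by_cases h : I' = I
        · rw [h]; exact hI
        · have h1 := hh I' hI' h
          have h2 := hDa l I I'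
          have h3 := hy0 I'
          nlinarith
      refine ⟨l, hl, fun I' hI' => by simpa using hbd I' hI', fun I' hI' h => ?_⟩
      have h1 := hh I' hI' h
      have h2 := hbd I' hI'
      have h3 : r * y I' < 1 * y I' := mul_lt_mul_of_pos_right hr1 (by linarith)
      linarith
  · left
    push Not at hbig
    set M : ℝ := ((Fintype.card C : ℝ) + 1) * D
    let Kset : Set (ℝ × (C → ℝ)) := (Set.Icc 0 1 ×ˢ Set.Icc 0 (fun _ => M)) ∩
      {q | DiscSol supp a q.1 q.2}
    have hK : IsCompact Kset := (isCompact_Icc.prod isCompact_Icc).inter_right (discSol_closed supp a)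
    have hcl : IsClosed (Prod.fst '' Kset) := (hK.image continuous_fst).isClosed
    have hsub : Set.Ico (0 : ℝ) 1 ⊆ Prod.fst '' Kset := by
      rintro r ⟨hr0, hr1⟩
      obtain ⟨y, hy0, hyS, hy⟩ := disc_aux supp a hs D hD hDa r hr0 hr1
      exact ⟨(r, y), ⟨⟨⟨hr0, hr1.le⟩, ⟨fun I => hy0 I, fun I => hbig r hr0 hr1 y hy0 hy I⟩⟩, hyS⟩, rfl⟩
    have h1 : (1 : ℝ) ∈ Prod.fst '' Kset := by
      have := closure_minimal hsub hcl
      rw [closure_Ico (by norm_num)] at this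
      exact this ⟨by norm_num, le_rfl⟩
    obtain ⟨⟨r, y⟩, ⟨-, hq⟩, rfl : r = 1⟩ := h1
    refine ⟨y, fun l => ?_⟩
    obtain ⟨I, hI, hmin⟩ := Finset.exists_min_image (supp l) (fun I => a l I + y I) (hne l)
    obtain ⟨I', hI', hn, hle⟩ := hq l I hI
    simp only [one_mul] at hle
    exact ⟨I, hI, I', hI', hn.symm, fun K hK => ⟨hmin K hK, hle.trans (hmin K hK)⟩⟩

theorem expDeg_add {n : ℕ} (I J : Exp n) : expDeg (I + J) = expDeg I + expDeg J := by
  simp [expDeg, Finset.sum_add_distrib]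

theorem expDeg_finite (n N : ℕ) : {I : Exp n | expDeg I ≤ N}.Finite := by
  refine (Set.finite_Iic (fun _ : Fin n => N)).subset fun I hI i => ?_
  exact (Finset.single_le_sum (f := I) (fun _ _ => Nat.zero_le _) (Finset.mem_univ i)).trans hI

theorem primary_forward (n k N : ℕ) (F : Fin k → TropPoly n)
    (hno : ¬ ∃ y : Exp n → ℝ, ∀ (j : Fin k) (J : Exp n), expDeg J + (F j).deg ≤ N →
      ∃ I ∈ (F j).supp, ∃ I' ∈ (F j).supp, I ≠ I' ∧ ∀ K ∈ (F j).supp,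
        (F j).coeff I + y (I + J) ≤ (F j).coeff K + y (K + J) ∧
        (F j).coeff I' + y (I' + J) ≤ (F j).coeff K + y (K + J)) :
    ∃ comb : TropComb n k, comb.DegLE F N ∧ comb.Nonsingular F := by
  let R : Type := {q : Exp n × Fin k // expDeg q.1 + (F q.2).deg ≤ N}
  let C : Type := {I : Exp n // expDeg I ≤ N}
  have : Finite C := expDeg_finite n N
  have : Finite R := by
    have : Finite (C × Fin k) := inferInstance
    refine Finite.of_injective
      (fun q : R => ((⟨q.1.1, (Nat.le_add_right _ _).trans q.2⟩, q.1.2) : C × Fin k)) ?_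
    rintro ⟨⟨J, j⟩, h⟩ ⟨⟨J', j'⟩, h'⟩ he
    simp only [Prod.mk.injEq] at he
    have h1 : J = J' := congrArg Subtype.val he.1
    exact Subtype.ext (Prod.ext h1 he.2)
  haveI : Fintype C := Fintype.ofFinite C
  haveI : Fintype R := Fintype.ofFinite R
  let supp : R → Finset C := fun q =>
    Finset.univ.filter (fun I => q.1.1 ≤ I.1 ∧ I.1 - q.1.1 ∈ (F q.1.2).supp)
  let a : R → C → ℝ := fun q I => (F q.1.2).coeff (I.1 - q.1.1)
  have hsupp : ∀ q I, I ∈ supp q ↔ (q.1.1 ≤ I.1 ∧ I.1 - q.1.1 ∈ (F q.1.2).supp) := by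
    intro q I; simp [supp]
  have hin : ∀ (q : R) (K : Exp n), K ∈ (F q.1.2).supp → expDeg (K + q.1.1) ≤ N := by
    intro q K hK
    rw [expDeg_add]
    have h1 := expDeg_le_deg _ hK
    have h2 := q.2
    omega
  have hmemK : ∀ (q : R) (K : Exp n) (hK : K ∈ (F q.1.2).supp),
      (⟨K + q.1.1, hin q K hK⟩ : C) ∈ supp q := by
    intro q K hK
    rw [hsupp]
    refine ⟨?_, ?_⟩
    · intro i; simp
    · simpa using hK
  have hne : ∀ q, (supp q).Nonempty := by
    intro q
    obtain ⟨K, hK⟩ := (F q.1.2).supp_nonempty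
    exact ⟨_, hmemK q K hK⟩
  rcases duality_aux supp a hne with ⟨y, hy⟩ | ⟨C', y, hC', hy⟩
  · exfalso
    apply hno
    refine ⟨fun I => if h : expDeg I ≤ N then y ⟨I, h⟩ else 0, fun j J hJ => ?_⟩
    obtain ⟨I, hI, I', hI', hn, hmin⟩ := hy ⟨(J, j), hJ⟩
    rw [hsupp] at hI hI'
    have e1 : I.1 - J + J = I.1 := tsub_add_cancel_of_le hI.1
    have e2 : I'.1 - J + J = I'.1 := tsub_add_cancel_of_le hI'.1
    refine ⟨I.1 - J, hI.2, I'.1 - J, hI'.2, ?_, ?_⟩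
    · intro h
      apply hn
      apply Subtype.ext
      rw [← e1, ← e2, h]
    · intro K hK
      have hk := hin ⟨(J, j), hJ⟩ K hK
      have := hmin _ (hmemK ⟨(J, j), hJ⟩ K hK)
      simp only [a, add_tsub_cancel_right] at this
      simp only at hk
      beta_reduce
      rw [e1, e2, dif_pos I.2, dif_pos I'.2, dif_pos hk]
      exact this
  · choose ρ hρ1 hρ2 hρ3 using hy
    let e : C' ≃ Fin C'.card := C'.equivFin
    have hpos : 0 < C'.card := Finset.card_pos.2 hC'
    let row : Fin C'.card → R := fun l => ρ (e.symm l).1 (e.symm l).2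
    let comb : TropComb n k :=
      { K := C'.card
        K_pos := hpos
        c := fun l => -(a (row l) (e.symm l).1 + y (e.symm l).1)
        J := fun l => (row l).1.1
        idx := fun l => (row l).1.2 }
    have hterm1 : ∀ (l : Fin C'.card) (I : C), I ∈ supp (row l) →
        comb.term F l I.1 =
          ((-(a (row l) (e.symm l).1 + y (e.symm l).1) + a (row l) I : ℝ) : WithTop ℝ) := by
      intro l I hI
      rw [hsupp] at hI
      simp only [TropComb.term, comb, shiftCoeff]
      rw [if_pos hI, ← WithTop.coe_add]
    have hterm2 : ∀ (l : Fin C'.card) (I : Exp n), (¬ ∃ I0 : C, I0.1 = I ∧ I0 ∈ supp (row l)) →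
        comb.term F l I = ⊤ := by
      intro l I hI
      simp only [TropComb.term, comb, shiftCoeff]
      rw [if_neg, WithTop.add_top]
      intro h
      apply hI
      have h1 := hin (row l) _ h.2
      have h2 := hmemK (row l) _ h.2
      have e1 : I - (row l).1.1 + (row l).1.1 = I := tsub_add_cancel_of_le h.1
      refine ⟨⟨I, by rw [← e1]; exact h1⟩, rfl, ?_⟩
      rw [hsupp]; exact h
    have hfinite : ∀ I : Exp n, comb.gCoeff F I ≠ ⊤ → ∃ I0 : C, I0.1 = I ∧ I0 ∈ C' := by
      intro I hI
      by_contra hcon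
      apply hI
      rw [TropComb.gCoeff]
      refine (Finset.inf_eq_top_iff _ _).2 fun l _ => hterm2 l I ?_
      rintro ⟨I0, h0, hI0⟩
      exact hcon ⟨I0, h0, hρ2 _ _ hI0⟩
    have main : ∀ (I0 : C) (h2 : I0 ∈ C') (l : Fin C'.card), l ≠ e ⟨I0, h2⟩ →
        comb.term F (e ⟨I0, h2⟩) I0.1 < comb.term F l I0.1 := by
      intro I0 h2 l hl
      set l0 := e ⟨I0, h2⟩ with hl0
      have es : e.symm l0 = ⟨I0, h2⟩ := by simp [hl0]
      have hI0 : I0 ∈ supp (row l0) := by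
        have := hρ1 _ (e.symm l0).2
        simp only [row]
        convert this using 1
        rw [es]
      have hterm0 : comb.term F l0 I0.1 = ((-y I0 : ℝ) : WithTop ℝ) := by
        rw [hterm1 l0 I0 hI0, es]
        congr 1
        ring
      rw [hterm0]
      by_cases hm : I0 ∈ supp (row l)
      · rw [hterm1 l I0 hm, WithTop.coe_lt_coe]
        have hne' : I0 ≠ (e.symm l).1 := by
          intro heq
          apply hl
          rw [hl0, ← e.symm_apply_eq]
          exact Subtype.ext heq.symm
        have := hρ3 _ (e.symm l).2 I0 hm hne'
        simp only [row]
        linarith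
      · rw [hterm2]
        · exact WithTop.coe_lt_top _
        · rintro ⟨I1, h3, h4⟩
          apply hm
          have : I1 = I0 := Subtype.ext h3
          rwa [← this]
    refine ⟨comb, fun l => (row l).2, ?_⟩
    refine ⟨fun I => if h : ∃ I0 : C, I0.1 = I ∧ I0 ∈ C' then e ⟨h.choose, h.choose_spec.2⟩
      else ⟨0, hpos⟩, ?_, ?_⟩
    · intro I hI l hl
      have h := hfinite I hI
      simp only [dif_pos h] at hl ⊢
      have h3 := main _ h.choose_spec.2 l hl
      have h1 := h.choose_spec.1
      generalize e ⟨h.choose, h.choose_spec.2⟩ = l0 at h3 ⊢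
      rw [h1] at h3
      exact h3
    · intro I I' hI hI' hn
      have h := hfinite I hI
      have h' := hfinite I' hI'
      simp only [dif_pos h, dif_pos h']
      intro heq
      have := e.injective heq
      rw [Subtype.mk.injEq] at this
      apply hn
      rw [← h.choose_spec.1, ← h'.choose_spec.1, this]

theorem primary_backward (n k : ℕ) (F : Fin k → TropPoly n) (a : Fin n → ℝ)
    (ha : ∀ j, (F j).IsRoot a) (comb : TropComb n k) (hns : comb.Nonsingular F) : False := by
  obtain ⟨sel, h1, h2⟩ := hns
  -- for each row, the two minimizing columns
  have hroot : ∀ l : Fin comb.K, ∃ I ∈ (F (comb.idx l)).supp, ∃ I' ∈ (F (comb.idx l)).supp, I ≠ I' ∧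
      (F (comb.idx l)).mono I a = (F (comb.idx l)).eval a ∧
      (F (comb.idx l)).mono I' a = (F (comb.idx l)).eval a := fun l => ha (comb.idx l)
  let v : Fin comb.K → ℝ := fun l =>
    comb.c l + (F (comb.idx l)).eval a + ∑ i, (comb.J l i : ℝ) * a i
  have : Nonempty (Fin comb.K) := ⟨⟨0, comb.K_pos⟩⟩
  obtain ⟨l, hl⟩ := Finite.exists_min v
  obtain ⟨I, hI, I', hI', hne, hIv, hIv'⟩ := hroot l
  have hterm : ∀ (l : Fin comb.K) (K : Exp n), K ∈ (F (comb.idx l)).supp →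
      comb.term F l (K + comb.J l) = ((comb.c l + (F (comb.idx l)).coeff K : ℝ) : WithTop ℝ) := by
    intro l K hK
    simp only [TropComb.term, shiftCoeff]
    rw [if_pos]
    · simp
    · refine ⟨fun i => by simp, by simpa using hK⟩
  have hg : ∀ K : Exp n, K ∈ (F (comb.idx l)).supp → comb.gCoeff F (K + comb.J l) ≠ ⊤ := by
    intro K hK h
    rw [TropComb.gCoeff, Finset.inf_eq_top_iff] at h
    have := h l (Finset.mem_univ l)
    rw [hterm l K hK] at this
    exact WithTop.coe_ne_top this
  have hsel : ∀ K : Exp n, K ∈ (F (comb.idx l)).supp →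
      (F (comb.idx l)).mono K a = (F (comb.idx l)).eval a → sel (K + comb.J l) = l := by
    intro K hK hKv
    by_contra hcon
    have hlt := h1 _ (hg K hK) l (fun h => hcon h.symm)
    set l' := sel (K + comb.J l)
    rw [hterm l K hK] at hlt
    simp only [TropComb.term, shiftCoeff] at hlt
    split_ifs at hlt with hc
    · rw [← WithTop.coe_add, WithTop.coe_lt_coe] at hlt
      have h3 := hl l'
      have h4 : (F (comb.idx l')).eval a ≤ (F (comb.idx l')).mono (K + comb.J l - comb.J l') a :=
        Finset.inf'_le _ hc.2
      have h5 : ∑ i, ((K + comb.J l - comb.J l') i : ℝ) * a i =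
          ∑ i, (K i : ℝ) * a i + ∑ i, (comb.J l i : ℝ) * a i - ∑ i, (comb.J l' i : ℝ) * a i := by
        rw [← Finset.sum_add_distrib, ← Finset.sum_sub_distrib]
        refine Finset.sum_congr rfl fun i _ => ?_
        have := Nat.cast_sub (R := ℝ) (hc.1 i)
        simp only [Pi.sub_apply, Pi.add_apply] at this ⊢
        rw [this]
        push_cast
        ring
      simp only [TropPoly.mono] at hKv h4
      simp only [v] at h3
      linarith
    · simp at hlt
  refine h2 _ _ (hg I hI) (hg I' hI') (fun h => hne (add_right_cancel h)) ?_
  rw [hsel I hI hIv, hsel I' hI' hIv']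

/-- **Tropical primary Nullstellensatz over ℝ** : a system `F = {f_1, …, f_k}` of tropical
polynomials in `n` variables over `ℝ` has no root iff there is a nonsingular tropical
algebraic combination of `F` of degree at most `N = (n+2)(d_1 + ⋯ + d_k)`. -/
theorem tropical_primary_nullstellensatz_real (n k : ℕ) (hk : 1 ≤ k)
    (F : Fin k → TropPoly n) :
    (¬ ∃ a : Fin n → ℝ, ∀ j : Fin k, (F j).IsRoot a) ↔
      ∃ comb : TropComb n k,
        comb.DegLE F ((n + 2) * ∑ j, (F j).deg) ∧ comb.Nonsingular F := by
  constructor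
  · intro h
    refine primary_forward n k _ F ?_
    rintro ⟨y, hy⟩
    exact h (dual_null_aux n k F y hy)
  · rintro ⟨comb, -, hns⟩ ⟨a, ha⟩
    exact primary_backward n k F a ha comb hns
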